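/- Let f : [0,1] → [0,1] be C² with finitely many non-flat critical points, all periodic points hyperbolic repelling, and let U be an open neighborhood of Crit(f). Then there exist C > 0 and λ > 1 such that for every x ∈ [0,1] and n ≥ 1 with x, f(x), …, f^{n-1}(x) ∉ U, one has |Df^n(x)| ≥ Cλ^n. -/

import Mathlib

open Set
open Filter Topology

/-- The product of the moduli of `φ` along the first `n` points of the `F`-orbit of `x`;
if `φ` is the derivative of `F`, this is `|(F^[n])' x|`. -/
noncomputable def orbitProd (F φ : ℝ → ℝ) (n : ℕ) (x : ℝ) : ℝ :=
  ∏ i ∈ Finset.range n, |φ (F^[i] x)|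

/-- A differentiable map of the line, with derivative `φ` of bounded distortion near the compact
set `K ⊆ [0, 1]`, which preserves `[0, 1]` and all of whose periodic points there are repelling. -/
structure RepellingSystem (F φ : ℝ → ℝ) (K : Set ℝ) (c C ρ : ℝ) : Prop where
  hasDerivAt : ∀ x, HasDerivAt F (φ x) x
  continuous_deriv : Continuous φ
  mapsTo : MapsTo F (Icc 0 1) (Icc 0 1)
  repelling : ∀ x ∈ Icc (0 : ℝ) 1, ∀ n : ℕ, 1 ≤ n → F^[n] x = x → 1 < orbitProd F φ n x
  isCompact : IsCompact K
  subset : K ⊆ Icc 0 1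
  c_pos : 0 < c
  c_le_one : c ≤ 1
  C_nonneg : 0 ≤ C
  ρ_pos : 0 < ρ
  ρ_le_one : ρ ≤ 1
  lower : ∀ q ∈ K, ∀ u, |u - q| ≤ ρ → c ≤ |φ u|
  distortion : ∀ q ∈ K, ∀ u v, |u - q| ≤ ρ → |v - q| ≤ ρ →
    |φ u| ≤ Real.exp (C * |u - v|) * |φ v|

lemma orbitProd_zero (F φ : ℝ → ℝ) (x : ℝ) : orbitProd F φ 0 x = 1 := by simp [orbitProd]

lemma orbitProd_nonneg (F φ : ℝ → ℝ) (n : ℕ) (x : ℝ) : 0 ≤ orbitProd F φ n x :=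
  Finset.prod_nonneg fun _ _ => abs_nonneg _

lemma orbitProd_succ (F φ : ℝ → ℝ) (n : ℕ) (x : ℝ) :
    orbitProd F φ (n + 1) x = orbitProd F φ n x * |φ (F^[n] x)| :=
  Finset.prod_range_succ _ _

lemma orbitProd_add (F φ : ℝ → ℝ) (m n : ℕ) (x : ℝ) :
    orbitProd F φ (m + n) x = orbitProd F φ m x * orbitProd F φ n (F^[m] x) := by
  simp only [orbitProd, Finset.prod_range_add]
  congr 1
  refine Finset.prod_congr rfl fun i _ => ?_
  rw [add_comm m i, Function.iterate_add_apply]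

lemma exists_hasDerivAt_iterate {F φ : ℝ → ℝ} (hF : ∀ x, HasDerivAt F (φ x) x) (n : ℕ) (x : ℝ) :
    ∃ d, HasDerivAt F^[n] d x ∧ |d| = orbitProd F φ n x := by
  induction n with
  | zero => exact ⟨1, hasDerivAt_id x, by simp [orbitProd_zero]⟩
  | succ n ih =>
    obtain ⟨d, hd, hd'⟩ := ih
    refine ⟨φ (F^[n] x) * d, ?_, ?_⟩
    · rw [Function.iterate_succ']
      exact (hF _).comp x hd
    · rw [orbitProd_succ, abs_mul, hd', mul_comm]

namespace RepellingSystem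

variable {F φ : ℝ → ℝ} {K : Set ℝ} {c C ρ : ℝ}

lemma continuous (h : RepellingSystem F φ K c C ρ) : Continuous F :=
  continuous_iff_continuousAt.2 fun x => (h.hasDerivAt x).continuousAt

lemma continuous_orbitProd (h : RepellingSystem F φ K c C ρ) (n : ℕ) :
    Continuous (orbitProd F φ n) :=
  continuous_finsetProd _ fun i _ => (h.continuous_deriv.comp (h.continuous.iterate i)).abs

lemma exists_slope (h : RepellingSystem F φ K c C ρ) (u v : ℝ) :
    ∃ ξ ∈ uIcc u v, F u - F v = φ ξ * (u - v) := by
  rcases lt_trichotomy u v with huv | rfl | huv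
  · obtain ⟨ξ, hξ, e⟩ := exists_hasDerivAt_eq_slope F φ huv h.continuous.continuousOn
      fun x _ => h.hasDerivAt x
    refine ⟨ξ, by rw [uIcc_of_le huv.le]; exact Ioo_subset_Icc_self hξ, ?_⟩
    rw [eq_div_iff (by linarith)] at e
    linarith
  · exact ⟨u, by simp, by simp⟩
  · obtain ⟨ξ, hξ, e⟩ := exists_hasDerivAt_eq_slope F φ huv h.continuous.continuousOn
      fun x _ => h.hasDerivAt x
    refine ⟨ξ, by rw [uIcc_of_ge huv.le]; exact Ioo_subset_Icc_self hξ, ?_⟩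
    rw [eq_div_iff (by linarith)] at e
    linarith

lemma ball_convex {q u v ξ : ℝ} (hu : |u - q| ≤ ρ) (hv : |v - q| ≤ ρ) (hξ : ξ ∈ uIcc u v) :
    |ξ - q| ≤ ρ := by
  rw [mem_uIcc] at hξ
  rw [abs_le] at *
  rcases hξ with hξ | hξ <;> constructor <;> linarith

lemma expand (h : RepellingSystem F φ K c C ρ) {q u v : ℝ} (hq : q ∈ K) (hu : |u - q| ≤ ρ)
    (hv : |v - q| ≤ ρ) : c * |u - v| ≤ |F u - F v| := by
  obtain ⟨ξ, hξ, e⟩ := h.exists_slope u v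
  rw [e, abs_mul]
  exact mul_le_mul_of_nonneg_right (h.lower q hq ξ (ball_convex hu hv hξ)) (abs_nonneg _)

lemma injOn (h : RepellingSystem F φ K c C ρ) {q : ℝ} (hq : q ∈ K) :
    InjOn F (Icc (q - ρ) (q + ρ)) := by
  intro u hu v hv e
  have := h.expand hq (u := u) (v := v) (abs_le.2 ⟨by linarith [hu.1], by linarith [hu.2]⟩)
    (abs_le.2 ⟨by linarith [hv.1], by linarith [hv.2]⟩)
  rw [e, sub_self, abs_zero] at this
  have h0 : |u - v| = 0 := by
    have := h.c_pos
    have := abs_nonneg (u - v)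
    nlinarith
  linarith [abs_eq_zero.1 h0]

lemma strictMonoOn_or (h : RepellingSystem F φ K c C ρ) {q : ℝ} (hq : q ∈ K) :
    StrictMonoOn F (Icc (q - ρ) (q + ρ)) ∨ StrictAntiOn F (Icc (q - ρ) (q + ρ)) :=
  ContinuousOn.strictMonoOn_of_injOn_Icc' (by linarith [h.ρ_pos]) h.continuous.continuousOn
    (h.injOn hq)

lemma map_uIoo (h : RepellingSystem F φ K c C ρ) {q u v s : ℝ} (hq : q ∈ K) (hu : |u - q| ≤ ρ)
    (hv : |v - q| ≤ ρ) (hs : s ∈ uIoo u v) : F s ∈ uIoo (F u) (F v) := by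
  have hs' := ball_convex hu hv (uIoo_subset_uIcc_self hs)
  rw [abs_le] at hu hv hs'
  have mu : u ∈ Icc (q - ρ) (q + ρ) := ⟨by linarith, by linarith⟩
  have mv : v ∈ Icc (q - ρ) (q + ρ) := ⟨by linarith, by linarith⟩
  have ms : s ∈ Icc (q - ρ) (q + ρ) := ⟨by linarith, by linarith⟩
  rcases le_total u v with huv | huv <;> rcases h.strictMonoOn_or hq with hm | hm
  · rw [uIoo_of_le huv] at hs
    rw [uIoo_of_le (hm.monotoneOn mu mv huv)]
    exact ⟨hm mu ms hs.1, hm ms mv hs.2⟩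
  · rw [uIoo_of_le huv] at hs
    rw [uIoo_of_ge (hm.antitoneOn mu mv huv)]
    exact ⟨hm ms mv hs.2, hm mu ms hs.1⟩
  · rw [uIoo_of_ge huv] at hs
    rw [uIoo_of_ge (hm.monotoneOn mv mu huv)]
    exact ⟨hm mv ms hs.1, hm ms mu hs.2⟩
  · rw [uIoo_of_ge huv] at hs
    rw [uIoo_of_le (hm.antitoneOn mv mu huv)]
    exact ⟨hm ms mu hs.2, hm mv ms hs.1⟩

lemma map_uIcc (h : RepellingSystem F φ K c C ρ) {q u v s : ℝ} (hq : q ∈ K) (hu : |u - q| ≤ ρ)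
    (hv : |v - q| ≤ ρ) (hs : s ∈ uIcc u v) : F s ∈ uIcc (F u) (F v) := by
  by_cases h1 : s = u
  · rw [h1]; exact left_mem_uIcc
  by_cases h2 : s = v
  · rw [h2]; exact right_mem_uIcc
  refine uIoo_subset_uIcc_self (h.map_uIoo hq hu hv ?_)
  rcases le_total u v with huv | huv
  · rw [uIcc_of_le huv] at hs
    rw [uIoo_of_le huv]
    exact ⟨lt_of_le_of_ne hs.1 (Ne.symm h1), lt_of_le_of_ne hs.2 h2⟩
  · rw [uIcc_of_ge huv] at hs
    rw [uIoo_of_ge huv]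
    exact ⟨lt_of_le_of_ne hs.1 (Ne.symm h2), lt_of_le_of_ne hs.2 h1⟩

/-- Points near `F q` have preimages near `q`. -/
lemma exists_preimage (h : RepellingSystem F φ K c C ρ) {q v : ℝ} (hq : q ∈ K)
    (hv : |v - F q| ≤ c * ρ) : ∃ u, |u - q| ≤ ρ ∧ F u = v := by
  have hρ := h.ρ_pos
  have e1 := h.expand hq (u := q + ρ) (v := q) (by simp [abs_of_pos hρ]) (by simp [hρ.le])
  have e2 := h.expand hq (u := q - ρ) (v := q) (by simp [abs_of_pos hρ]) (by simp [hρ.le])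
  have a1 : |q + ρ - q| = ρ := by simp [abs_of_pos hρ]
  have a2 : |q - ρ - q| = ρ := by simp [abs_of_pos hρ]
  rw [a1] at e1
  rw [a2] at e2
  have hsub : v ∈ uIcc (F (q - ρ)) (F (q + ρ)) := by
    have m0 : q ∈ Icc (q - ρ) (q + ρ) := ⟨by linarith, by linarith⟩
    have m1 : q - ρ ∈ Icc (q - ρ) (q + ρ) := ⟨by linarith, by linarith⟩
    have m2 : q + ρ ∈ Icc (q - ρ) (q + ρ) := ⟨by linarith, by linarith⟩
    rw [abs_le] at hv
    rw [mem_uIcc]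
    rcases h.strictMonoOn_or hq with hm | hm
    · have := hm m1 m0 (by linarith)
      have := hm m0 m2 (by linarith)
      rw [abs_of_pos (by linarith)] at e1
      rw [abs_of_neg (by linarith)] at e2
      left; constructor <;> linarith
    · have := hm m1 m0 (by linarith)
      have := hm m0 m2 (by linarith)
      rw [abs_of_neg (by linarith)] at e1
      rw [abs_of_pos (by linarith)] at e2
      right; constructor <;> linarith
  obtain ⟨u, hu, e⟩ := intermediate_value_uIcc h.continuous.continuousOn hsub
  rw [uIcc_of_le (by linarith)] at hu
  exact ⟨u, abs_le.2 ⟨by linarith [hu.1], by linarith [hu.2]⟩, e⟩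

/-- Ratios of lengths inside the interval between `q` and `b` are almost preserved by `F`. -/
lemma ratio_step (h : RepellingSystem F φ K c C ρ) {q b u v u' v' : ℝ} (hq : q ∈ K)
    (hb : |b - q| ≤ ρ) (hu : u ∈ uIcc q b) (hv : v ∈ uIcc q b) (hu' : u' ∈ uIcc q b)
    (hv' : v' ∈ uIcc q b) :
    |F u - F v| * |u' - v'| ≤ Real.exp (C * |b - q|) * (|F u' - F v'| * |u - v|) := by
  obtain ⟨ξ, hξ, e⟩ := h.exists_slope u v
  obtain ⟨ξ', hξ', e'⟩ := h.exists_slope u' v'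
  have k := uIcc_subset_uIcc hu hv hξ
  have k' := uIcc_subset_uIcc hu' hv' hξ'
  have hqq : |q - q| ≤ ρ := by simp [h.ρ_pos.le]
  have hd := h.distortion q hq ξ ξ' (ball_convex hqq hb k) (ball_convex hqq hb k')
  have hle : |ξ - ξ'| ≤ |b - q| := abs_sub_le_of_uIcc_subset_uIcc (uIcc_subset_uIcc k' k)
  have hexp : Real.exp (C * |ξ - ξ'|) ≤ Real.exp (C * |b - q|) :=
    Real.exp_le_exp.2 (mul_le_mul_of_nonneg_left hle h.C_nonneg)
  rw [e, e', abs_mul, abs_mul]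
  calc |φ ξ| * |u - v| * |u' - v'| = |φ ξ| * (|u - v| * |u' - v'|) := by ring
    _ ≤ (Real.exp (C * |b - q|) * |φ ξ'|) * (|u - v| * |u' - v'|) := by
        refine mul_le_mul_of_nonneg_right (hd.trans ?_) (by positivity)
        exact mul_le_mul_of_nonneg_right hexp (abs_nonneg _)
    _ = _ := by ring

lemma orbitProd_pos (h : RepellingSystem F φ K c C ρ) {n : ℕ} {x : ℝ}
    (hx : ∀ i < n, F^[i] x ∈ K) : 0 < orbitProd F φ n x :=
  Finset.prod_pos fun i hi => h.c_pos.trans_le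
    (h.lower _ (hx i (Finset.mem_range.1 hi)) _ (by simp [h.ρ_pos.le]))

lemma iterate_ne_of_bounded (h : RepellingSystem F φ K c C ρ) {q B : ℝ} (hq : q ∈ Icc (0 : ℝ) 1)
    (hB : ∀ n, orbitProd F φ n q ≤ B) {j : ℕ} (hj : 1 ≤ j) : F^[j] q ≠ q := by
  intro e
  have hpow : ∀ i : ℕ, orbitProd F φ (j * i) q = orbitProd F φ j q ^ i := by
    intro i
    induction i with
    | zero => simp [orbitProd_zero]
    | succ i ih =>
      rw [Nat.mul_succ, add_comm, orbitProd_add, e, ih, pow_succ, mul_comm]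
  obtain ⟨i, hi⟩ := pow_unbounded_of_one_lt B (h.repelling q hq j hj e)
  linarith [hB (j * i), hpow i]

/-- If the derivatives along an orbit are summable, a whole neighbourhood follows the orbit with
bounded distortion. -/
lemma exists_neighborhood_of_sum_le (h : RepellingSystem F φ K c C ρ) {q A : ℝ}
    (hq : ∀ i, F^[i] q ∈ K) (hA : ∀ n, ∑ i ∈ Finset.range n, orbitProd F φ i q ≤ A) :
    ∃ τ > 0, ∀ u, |u - q| ≤ τ → ∀ n, |F^[n] u - F^[n] q| ≤ 2 * orbitProd F φ n q * τ ∧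
      orbitProd F φ n u ≤ 2 * orbitProd F φ n q := by
  have hA1 : 1 ≤ A := by simpa [orbitProd_zero] using hA 1
  have hC := h.C_nonneg
  have hρ := h.ρ_pos
  have hlog : 0 < Real.log 2 := Real.log_pos one_lt_two
  have hP : ∀ n, orbitProd F φ n q ≤ A := fun n =>
    (Finset.single_le_sum (f := fun i => orbitProd F φ i q)
      (fun i _ => orbitProd_nonneg F φ i q) (Finset.self_mem_range_succ n)).trans (hA (n + 1))
  obtain ⟨τ, hτ, hτ1, hτ2⟩ : ∃ τ > 0, 2 * A * τ ≤ ρ ∧ C * (2 * A * τ) ≤ Real.log 2 := by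
    refine ⟨min (ρ / (2 * A)) (Real.log 2 / ((C + 1) * (2 * A))), by positivity, ?_, ?_⟩
    · have := min_le_left (ρ / (2 * A)) (Real.log 2 / ((C + 1) * (2 * A)))
      rwa [le_div_iff₀' (by positivity)] at this
    · have := min_le_right (ρ / (2 * A)) (Real.log 2 / ((C + 1) * (2 * A)))
      rw [le_div_iff₀' (by positivity)] at this
      have h0 : 0 < min (ρ / (2 * A)) (Real.log 2 / ((C + 1) * (2 * A))) := by positivity
      have : 0 < 2 * A * min (ρ / (2 * A)) (Real.log 2 / ((C + 1) * (2 * A))) := by positivity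
      nlinarith
  refine ⟨τ, hτ, fun u hu => ?_⟩
  set E : ℕ → ℝ := fun n =>
    Real.exp (C * (2 * (∑ i ∈ Finset.range n, orbitProd F φ i q) * τ)) with hE
  have hE2 : ∀ n, E n ≤ 2 := by
    intro n
    refine (Real.le_log_iff_exp_le (by norm_num)).1 (le_trans ?_ hτ2)
    exact mul_le_mul_of_nonneg_left
      (mul_le_mul_of_nonneg_right (by linarith [hA n]) hτ.le) hC
  have key : ∀ n, |F^[n] u - F^[n] q| ≤ E n * orbitProd F φ n q * τ ∧
      orbitProd F φ n u ≤ E n * orbitProd F φ n q := by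
    intro n
    induction n with
    | zero => simpa [hE, orbitProd_zero] using hu
    | succ n ih =>
      obtain ⟨ih1, ih2⟩ := ih
      have hPn := orbitProd_nonneg F φ n q
      have hdist : |F^[n] u - F^[n] q| ≤ 2 * orbitProd F φ n q * τ := by
        refine ih1.trans ?_
        have := hE2 n
        gcongr
      have hdist' : |F^[n] u - F^[n] q| ≤ ρ := by
        refine hdist.trans (le_trans ?_ hτ1)
        have := hP n
        gcongr
      have hE_succ : E (n + 1) = Real.exp (C * (2 * orbitProd F φ n q * τ)) * E n := by
        simp only [hE]
        rw [← Real.exp_add, Finset.sum_range_succ]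
        ring_nf
      have hφ : ∀ ξ ∈ uIcc (F^[n] u) (F^[n] q),
          |φ ξ| ≤ Real.exp (C * (2 * orbitProd F φ n q * τ)) * |φ (F^[n] q)| := by
        intro ξ hξ
        have hqq : |F^[n] q - F^[n] q| ≤ ρ := by simp [hρ.le]
        refine (h.distortion _ (hq n) ξ (F^[n] q) (ball_convex hdist' hqq hξ) hqq).trans ?_
        refine mul_le_mul_of_nonneg_right (Real.exp_le_exp.2 ?_) (abs_nonneg _)
        refine mul_le_mul_of_nonneg_left (le_trans ?_ hdist) hC
        rw [abs_sub_comm ξ, abs_sub_comm (F^[n] u)]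
        exact abs_sub_le_of_uIcc_subset_uIcc (uIcc_subset_uIcc_right hξ)
      constructor
      · obtain ⟨ξ, hξ, e⟩ := h.exists_slope (F^[n] u) (F^[n] q)
        rw [Function.iterate_succ_apply', Function.iterate_succ_apply', e, abs_mul, hE_succ,
          orbitProd_succ]
        calc |φ ξ| * |F^[n] u - F^[n] q|
            ≤ (Real.exp (C * (2 * orbitProd F φ n q * τ)) * |φ (F^[n] q)|) *
              (E n * orbitProd F φ n q * τ) :=
              mul_le_mul (hφ ξ hξ) ih1 (abs_nonneg _) (by positivity)
          _ = _ := by ring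
      · rw [orbitProd_succ, orbitProd_succ, hE_succ]
        calc orbitProd F φ n u * |φ (F^[n] u)|
            ≤ (E n * orbitProd F φ n q) *
              (Real.exp (C * (2 * orbitProd F φ n q * τ)) * |φ (F^[n] q)|) :=
              mul_le_mul ih2 (hφ _ left_mem_uIcc) (abs_nonneg _) (by positivity)
          _ = _ := by ring
  intro n
  obtain ⟨k1, k2⟩ := key n
  have := hE2 n
  have hPn := orbitProd_nonneg F φ n q
  exact ⟨k1.trans (by gcongr), k2.trans (by gcongr)⟩

lemma not_sum_le_of_recurrent (h : RepellingSystem F φ K c C ρ) {q A : ℝ}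
    (hq : ∀ i, F^[i] q ∈ K) (hA : ∀ n, ∑ i ∈ Finset.range n, orbitProd F φ i q ≤ A)
    (hrec : ∀ k : ℕ, q ∈ closure ((fun i => F^[i] q) '' Ici k)) : False := by
  obtain ⟨τ, hτ, hτ'⟩ := h.exists_neighborhood_of_sum_le hq hA
  have hlim := (summable_of_sum_range_le (fun i => orbitProd_nonneg F φ i q) hA).tendsto_atTop_zero
  obtain ⟨k, hk⟩ := eventually_atTop.1 (hlim.eventually_lt_const (show (0 : ℝ) < 1 / 4 by norm_num))
  obtain ⟨-, ⟨n, hn, rfl⟩, hdist⟩ := Metric.mem_closure_iff.1 (hrec (k + 1)) (τ / 2) (by positivity)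
  have hn : k + 1 ≤ n := hn
  have hP := hk n (by omega)
  rw [Real.dist_eq, abs_sub_comm] at hdist
  have hq0 : q ∈ Icc (0 : ℝ) 1 := h.subset (hq 0)
  have hle : max 0 (q - τ) ≤ min 1 (q + τ) :=
    (max_le hq0.1 (by linarith)).trans (le_min hq0.2 (by linarith))
  obtain ⟨p, hp, hfix⟩ := exists_mem_Icc_isFixedPt_of_mapsTo (h.continuous.iterate n).continuousOn
    hle (f := F^[n]) (by
      intro u hu
      obtain ⟨h1, h2⟩ := hu
      rw [max_le_iff] at h1
      rw [le_min_iff] at h2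
      have h3 := (hτ' u (abs_le.2 ⟨by linarith, by linarith⟩) n).1
      have h4 := h.mapsTo.iterate n (show u ∈ Icc (0 : ℝ) 1 from ⟨h1.1, h2.1⟩)
      have h5 : |F^[n] u - F^[n] q| ≤ τ / 2 := h3.trans (by nlinarith)
      rw [abs_le] at h5
      rw [abs_lt] at hdist
      exact ⟨max_le h4.1 (by linarith), le_min h4.2 (by linarith)⟩)
  obtain ⟨h1, h2⟩ := hp
  rw [max_le_iff] at h1
  rw [le_min_iff] at h2
  have h3 := (hτ' p (abs_le.2 ⟨by linarith, by linarith⟩) n).2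
  have h4 := h.repelling p ⟨h1.1, h2.1⟩ n (by omega) hfix
  linarith

lemma exists_mem_omegaLimit (h : RepellingSystem F φ K c C ρ) {q B : ℝ}
    (hq : ∀ i, F^[i] q ∈ K) (hB : ∀ n, orbitProd F φ n q ≤ B) :
    ∃ y, (∀ k : ℕ, y ∈ closure ((fun i => F^[i] q) '' Ici k)) ∧ ∀ n, orbitProd F φ n y ≤ 1 := by
  set A : ℕ → Set ℝ := fun k => closure ((fun i => F^[i] q) '' Ici k) ∩
    {y | ∀ j, orbitProd F φ j y ≤ 1 + 1 / ((k : ℝ) + 1)} with hA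
  have hclosed : ∀ k, IsClosed (A k) := by
    intro k
    refine isClosed_closure.inter ?_
    rw [ofPred_forall]
    exact isClosed_iInter fun j => isClosed_le (h.continuous_orbitProd j) continuous_const
  have hsub : closure ((fun i => F^[i] q) '' Ici 0) ⊆ K :=
    closure_minimal (by rintro _ ⟨i, -, rfl⟩; exact hq i) h.isCompact.isClosed
  obtain ⟨y, hy⟩ := IsCompact.nonempty_iInter_of_sequence_nonempty_isCompact_isClosed A (by
      rintro k y ⟨hy1, hy2⟩
      refine ⟨closure_mono (image_mono (Ici_subset_Ici.2 k.le_succ)) hy1, fun j =>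
        (hy2 j).trans ?_⟩
      push_cast
      gcongr
      linarith) (by
      intro k
      have hbdd : BddAbove ((fun n => orbitProd F φ n q) '' Ici k) :=
        ⟨B, by rintro _ ⟨n, -, rfl⟩; exact hB n⟩
      set s := sSup ((fun n => orbitProd F φ n q) '' Ici k) with hs
      have hspos : 0 < s :=
        (h.orbitProd_pos (n := k) fun i _ => hq i).trans_le (le_csSup hbdd ⟨k, self_mem_Ici, rfl⟩)
      have hone : (1 : ℝ) < 1 + 1 / ((k : ℝ) + 1) := by
        have : 0 < 1 / ((k : ℝ) + 1) := by positivity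
        linarith
      obtain ⟨-, ⟨n, hn, rfl⟩, hlt⟩ := exists_lt_of_lt_csSup (Set.Nonempty.image _ ⟨k, self_mem_Ici⟩)
        (div_lt_self hspos hone)
      refine ⟨F^[n] q, subset_closure ⟨n, hn, rfl⟩, fun j => ?_⟩
      have h1 : orbitProd F φ (n + j) q ≤ s :=
        le_csSup hbdd ⟨n + j, le_trans (mem_Ici.1 hn) (Nat.le_add_right n j), rfl⟩
      rw [orbitProd_add] at h1
      have hpos := h.orbitProd_pos (n := n) fun i _ => hq i
      rw [← hs, div_lt_iff₀ (by linarith)] at hlt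
      refine le_of_mul_le_mul_left ?_ hpos
      linarith) (h.isCompact.of_isClosed_subset (hclosed 0) (inter_subset_left.trans hsub)) hclosed
  rw [mem_iInter] at hy
  refine ⟨y, fun k => (hy k).1, fun n => ?_⟩
  refine ge_of_tendsto (x := atTop) (f := fun k : ℕ => 1 + 1 / ((k : ℝ) + 1)) ?_
    (Eventually.of_forall fun k => (hy k).2 n)
  simpa using tendsto_one_div_add_atTop_nhds_zero_nat.const_add (1 : ℝ)

/-- A minimal closed invariant set carrying a point without expansion. -/
lemma exists_minimal (h : RepellingSystem F φ K c C ρ) {x : ℝ} (hx : ∀ i, F^[i] x ∈ K)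
    (hx1 : ∀ n, orbitProd F φ n x ≤ 1) :
    ∃ M : Set ℝ, IsClosed M ∧ M ⊆ K ∧ MapsTo F M M ∧ (∃ y ∈ M, ∀ n, orbitProd F φ n y ≤ 1) ∧
      ∀ q ∈ M, ∀ B, (∀ n, orbitProd F φ n q ≤ B) →
        ∀ k : ℕ, M ⊆ closure ((fun i => F^[i] q) '' Ici k) := by
  set S : Set (Set ℝ) := {M | IsClosed M ∧ M ⊆ K ∧ MapsTo F M M ∧
    ∃ y ∈ M, ∀ n, orbitProd F φ n y ≤ 1} with hS
  set N : Set ℝ := {y | ∀ n, orbitProd F φ n y ≤ 1} with hN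
  have hNclosed : IsClosed N := by
    rw [hN, ofPred_forall]
    exact isClosed_iInter fun j => isClosed_le (h.continuous_orbitProd j) continuous_const
  have hbase : {y | ∀ i, F^[i] y ∈ K} ∈ S := by
    refine ⟨?_, fun y hy => hy 0, fun y hy i => ?_, x, hx, hx1⟩
    · rw [ofPred_forall]
      exact isClosed_iInter fun i => h.isCompact.isClosed.preimage (h.continuous.iterate i)
    · rw [← Function.iterate_succ_apply]
      exact hy (i + 1)
  obtain ⟨M, -, hM⟩ := zorn_superset_nonempty S (by
    intro 𝒞 h𝒞 hchain hne
    have hcompact : ∀ A ∈ 𝒞, IsCompact A := fun A hA =>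
      h.isCompact.of_isClosed_subset (h𝒞 hA).1 (h𝒞 hA).2.1
    have hnonempty : (⋂₀ ((fun A => A ∩ N) '' 𝒞)).Nonempty := by
      have : Nonempty ((fun A => A ∩ N) '' 𝒞) := (hne.image _).to_subtype
      refine IsCompact.nonempty_sInter_of_directed_nonempty_isCompact_isClosed ?_ ?_ ?_ ?_
      · rintro _ ⟨A, hA, rfl⟩ _ ⟨A', hA', rfl⟩
        rcases hchain.total hA hA' with hle | hle
        · exact ⟨_, ⟨A, hA, rfl⟩, Subset.rfl, inter_subset_inter_left _ hle⟩
        · exact ⟨_, ⟨A', hA', rfl⟩, inter_subset_inter_left _ hle, Subset.rfl⟩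
      · rintro _ ⟨A, hA, rfl⟩
        obtain ⟨y, hy⟩ := (h𝒞 hA).2.2.2
        exact ⟨y, hy⟩
      · rintro _ ⟨A, hA, rfl⟩
        exact (hcompact A hA).inter_right hNclosed
      · rintro _ ⟨A, hA, rfl⟩
        exact (h𝒞 hA).1.inter hNclosed
    obtain ⟨y, hy⟩ := hnonempty
    have hy' : ∀ A ∈ 𝒞, y ∈ A ∩ N := fun A hA => hy _ ⟨A, hA, rfl⟩
    obtain ⟨A₀, hA₀⟩ := hne
    refine ⟨⋂₀ 𝒞, ⟨isClosed_sInter fun A hA => (h𝒞 hA).1, ?_, ?_, y, ?_, (hy' A₀ hA₀).2⟩,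
      fun A hA => sInter_subset_of_mem hA⟩
    · exact (sInter_subset_of_mem hA₀).trans (h𝒞 hA₀).2.1
    · exact fun z hz A hA => (h𝒞 hA).2.2.1 (hz A hA)
    · exact fun A hA => (hy' A hA).1) _ hbase
  obtain ⟨hMc, hMK, hMmaps, hMy⟩ := hM.prop
  refine ⟨M, hMc, hMK, hMmaps, hMy, fun q hq B hB k => ?_⟩
  have horb : ∀ i, F^[i] q ∈ M := fun i => hMmaps.iterate i hq
  obtain ⟨y, hy, hy1⟩ := h.exists_mem_omegaLimit (fun i => hMK (horb i)) hB
  have hωM : ⋂ k : ℕ, closure ((fun i => F^[i] q) '' Ici k) ⊆ M :=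
    (iInter_subset _ 0).trans
      (closure_minimal (by rintro _ ⟨i, -, rfl⟩; exact horb i) hMc)
  have hω : ⋂ k : ℕ, closure ((fun i => F^[i] q) '' Ici k) ∈ S := by
    refine ⟨isClosed_iInter fun _ => isClosed_closure, hωM.trans hMK, fun z hz => ?_, y,
      mem_iInter.2 hy, hy1⟩
    refine mem_iInter.2 fun k => ?_
    refine map_mem_closure h.continuous (mem_iInter.1 hz k) ?_
    rintro _ ⟨i, hi, rfl⟩
    exact ⟨i + 1, le_trans hi (Nat.le_succ i), Function.iterate_succ_apply' _ _ _⟩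
  exact (hM.le_of_le hω hωM).trans (iInter_subset _ k)

/-- On a minimal non-expanding set, sums of derivatives diverge uniformly. -/
lemma exists_lt_sum (h : RepellingSystem F φ K c C ρ) {M : Set ℝ} (hMc : IsClosed M)
    (hMK : M ⊆ K) (hMF : MapsTo F M M)
    (hmin : ∀ q ∈ M, ∀ B, (∀ n, orbitProd F φ n q ≤ B) →
      ∀ k : ℕ, M ⊆ closure ((fun i => F^[i] q) '' Ici k)) (A : ℝ) :
    ∃ N : ℕ, ∀ q ∈ M, A < ∑ i ∈ Finset.range N, orbitProd F φ i q := by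
  by_contra! hcon
  set T : ℕ → Set ℝ := fun N => M ∩ {q | ∑ i ∈ Finset.range N, orbitProd F φ i q ≤ A} with hT
  have hclosed : ∀ N, IsClosed (T N) := fun N => hMc.inter
    (isClosed_le (continuous_finsetSum _ fun i _ => h.continuous_orbitProd i) continuous_const)
  obtain ⟨q, hq⟩ := IsCompact.nonempty_iInter_of_sequence_nonempty_isCompact_isClosed T
    (fun N q hq => ⟨hq.1, (Finset.sum_le_sum_of_subset_of_nonneg
      (Finset.range_mono N.le_succ) fun i _ _ => orbitProd_nonneg F φ i q).trans hq.2⟩)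
    (fun N => by
      obtain ⟨q, hq, hq'⟩ := hcon N
      exact ⟨q, hq, hq'⟩)
    (h.isCompact.of_isClosed_subset (hclosed 0) (inter_subset_left.trans hMK)) hclosed
  rw [mem_iInter] at hq
  have hqM : q ∈ M := (hq 0).1
  have hsum : ∀ N, ∑ i ∈ Finset.range N, orbitProd F φ i q ≤ A := fun N => (hq N).2
  refine h.not_sum_le_of_recurrent (fun i => hMK (hMF.iterate i hqM)) hsum fun k =>
    hmin q hqM A (fun n => ?_) k hqM
  exact (Finset.single_le_sum (f := fun i => orbitProd F φ i q)
    (fun i _ => orbitProd_nonneg F φ i q) (Finset.self_mem_range_succ n)).trans (hsum (n + 1))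

end RepellingSystem

/-- An increasing map moving `w` to the right and `x > w` to the left has a fixed point in
between which is not repelling. -/
lemma exists_fixedPt_abs_deriv_le_one {g : ℝ → ℝ} (hg : Continuous g) {w x : ℝ} (hwx : w ≤ x)
    (hmono : StrictMonoOn g (Icc w x)) (hw : w < g w) (hx : g x ≤ x) :
    ∃ p ∈ Icc w x, g p = p ∧ ∀ d, HasDerivAt g d p → |d| ≤ 1 := by
  set S : Set ℝ := Icc w x ∩ {u | g u ≤ u} with hS
  have hSc : IsCompact S := isCompact_Icc.inter_right (isClosed_le hg continuous_id)
  obtain ⟨p, hp⟩ := hSc.exists_isLeast ⟨x, right_mem_Icc.2 hwx, hx⟩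
  obtain ⟨⟨hpI, hgp⟩, hleast⟩ := hp
  have hgp : g p ≤ p := hgp
  have hwp : w < p := lt_of_le_of_ne hpI.1 (by rintro rfl; linarith)
  have hlt : ∀ u ∈ Ico w p, u < g u := by
    intro u hu
    by_contra! hcon
    linarith [hleast ⟨⟨hu.1, hu.2.le.trans hpI.2⟩, hcon⟩, hu.2]
  have hev : ∀ᶠ u in 𝓝[<] p, u ∈ Ico w p := Ico_mem_nhdsLT hwp
  have hgp' : p ≤ g p := by
    have h1 : Tendsto g (𝓝[<] p) (𝓝 (g p)) := hg.continuousAt.tendsto.mono_left nhdsWithin_le_nhds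
    have h2 : Tendsto (fun u : ℝ => u) (𝓝[<] p) (𝓝 p) := tendsto_id.mono_left nhdsWithin_le_nhds
    exact le_of_tendsto_of_tendsto h2 h1 (hev.mono fun u hu => (hlt u hu).le)
  have hfix : g p = p := le_antisymm hgp hgp'
  refine ⟨p, hpI, hfix, fun d hd => ?_⟩
  have hslope : Tendsto (slope g p) (𝓝[<] p) (𝓝 d) :=
    (hasDerivAt_iff_tendsto_slope.1 hd).mono_left
      (nhdsWithin_mono p fun u (hu : u < p) => hu.ne)
  rw [abs_le]
  constructor
  · refine le_trans (by norm_num) (ge_of_tendsto hslope (b := 0) (hev.mono fun u hu => ?_))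
    rw [slope_def_field]
    have := hmono ⟨hu.1, hu.2.le.trans hpI.2⟩ hpI hu.2
    exact div_nonneg_of_nonpos (by linarith) (by linarith [hu.2])
  · refine le_of_tendsto hslope (hev.mono fun u hu => ?_)
    rw [slope_def_field, div_le_one_of_neg (by linarith [hu.2]), hfix]
    linarith [hlt u hu]

/-- Disjoint intervals in `[-1, 2]` have total length at most `3`. -/
lemma sum_abs_sub_le_three (s : Finset ℕ) (a b : ℕ → ℝ)
    (ha : ∀ l ∈ s, a l ∈ Icc (-1 : ℝ) 2) (hb : ∀ l ∈ s, b l ∈ Icc (-1 : ℝ) 2)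
    (hd : (s : Set ℕ).PairwiseDisjoint fun l => uIoo (a l) (b l)) :
    ∑ l ∈ s, |b l - a l| ≤ 3 := by
  have h1 := MeasureTheory.measure_biUnion_finset (μ := MeasureTheory.volume) hd
    fun l _ => isOpen_Ioo.measurableSet
  have h2 : ⋃ l ∈ s, uIoo (a l) (b l) ⊆ Icc (-1 : ℝ) 2 := by
    refine iUnion₂_subset fun l hl => uIoo_subset_uIcc_self.trans ?_
    exact ordConnected_Icc.uIcc_subset (ha l hl) (hb l hl)
  have h3 : ∀ l, MeasureTheory.volume (uIoo (a l) (b l)) = ENNReal.ofReal |b l - a l| := by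
    intro l
    rw [uIoo, Real.volume_Ioo, sup_sub_inf_eq_abs_sub]
  have h4 := MeasureTheory.measure_mono (μ := MeasureTheory.volume) h2
  rw [h1, Finset.sum_congr rfl fun l _ => h3 l, Real.volume_Icc,
    ← ENNReal.ofReal_sum_of_nonneg fun _ _ => abs_nonneg _] at h4
  have := (ENNReal.ofReal_le_ofReal_iff (by norm_num)).1 h4
  linarith

/-- If consecutive ratios of `a` and `b` change by controlled factors, so do distant ones. -/
lemma ratio_telescope {a b w : ℕ → ℝ} {i n : ℕ} {C : ℝ}
    (hb : ∀ l, i ≤ l → l ≤ n → 0 < b l)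
    (hstep : ∀ l, i ≤ l → l < n → a l * b (l + 1) ≤ Real.exp (C * w l) * (a (l + 1) * b l))
    (hin : i ≤ n) :
    a i * b n ≤ Real.exp (C * ∑ l ∈ Finset.Ico i n, w l) * (a n * b i) := by
  induction n, hin using Nat.le_induction with
  | base => simp
  | succ n hin ih =>
    have ih := ih (fun l h1 h2 => hb l h1 (by omega)) fun l h1 h2 => hstep l h1 (by omega)
    have hn := hstep n hin (by omega)
    have bn := hb n hin (by omega)
    have bn1 := hb (n + 1) (by omega) le_rfl
    have bi := hb i le_rfl (by omega)
    rw [Finset.sum_Ico_succ_top hin, mul_add, Real.exp_add]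
    refine le_of_mul_le_mul_right ?_ bn
    set E := Real.exp (C * ∑ l ∈ Finset.Ico i n, w l)
    have hE : 0 ≤ E := (Real.exp_pos _).le
    calc a i * b (n + 1) * b n = (a i * b n) * b (n + 1) := by ring
      _ ≤ (E * (a n * b i)) * b (n + 1) := mul_le_mul_of_nonneg_right ih bn1.le
      _ = (E * b i) * (a n * b (n + 1)) := by ring
      _ ≤ (E * b i) * (Real.exp (C * w n) * (a (n + 1) * b n)) :=
          mul_le_mul_of_nonneg_left hn (by positivity)
      _ = _ := by ring

/-- The interval between `F^[n] q` and `x + η`, together with its point `x`, pulled back along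
the orbit of `q` from time `n` to time `i`. -/
structure Pullback (F : ℝ → ℝ) (q x η ρ : ℝ) (n i : ℕ) (Y R : ℕ → ℝ) : Prop where
  le : i ≤ n
  map_left : ∀ l, i ≤ l → l < n → F (Y l) = Y (l + 1)
  map_right : ∀ l, i ≤ l → l < n → F (R l) = R (l + 1)
  near : ∀ l, i ≤ l → l ≤ n → |R l - F^[l] q| ≤ ρ
  mem : ∀ l, i ≤ l → l ≤ n → Y l ∈ uIcc (F^[l] q) (R l)
  left_eq : Y n = x
  right_eq : R n = x + η

namespace RepellingSystem

variable {F φ : ℝ → ℝ} {K : Set ℝ} {c C ρ : ℝ} {q x η : ℝ} {n i : ℕ} {Y R : ℕ → ℝ}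

lemma left_near (h : RepellingSystem F φ K c C ρ) (hp : Pullback F q x η ρ n i Y R) {l : ℕ}
    (h1 : i ≤ l) (h2 : l ≤ n) : |Y l - F^[l] q| ≤ ρ :=
  ball_convex (by simp [h.ρ_pos.le]) (hp.near l h1 h2) (hp.mem l h1 h2)

lemma pullback_mapsTo_injOn (h : RepellingSystem F φ K c C ρ) (hq : ∀ l, F^[l] q ∈ K)
    (hp : Pullback F q x η ρ n i Y R) {a : ℕ} (ha : i ≤ a) (k : ℕ) (hk : a + k ≤ n) :
    MapsTo F^[k] (uIcc (F^[a] q) (R a)) (uIcc (F^[a + k] q) (R (a + k))) ∧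
      InjOn F^[k] (uIcc (F^[a] q) (R a)) := by
  induction k with
  | zero => exact ⟨mapsTo_id _, injOn_id _⟩
  | succ k ih =>
    obtain ⟨ih1, ih2⟩ := ih (by omega)
    have hself : |F^[a + k] q - F^[a + k] q| ≤ ρ := by simp [h.ρ_pos.le]
    have hnear := hp.near (a + k) (by omega) (by omega)
    rw [Function.iterate_succ']
    constructor
    · intro s hs
      have := h.map_uIcc (hq (a + k)) hself hnear (ih1 hs)
      rwa [hp.map_right (a + k) (by omega) (by omega), ← Function.iterate_succ_apply' F] at this
    · refine InjOn.comp ((h.injOn (hq (a + k))).mono fun s hs => ?_) ih2 ih1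
      have := abs_le.1 (ball_convex hself hnear hs)
      exact ⟨by linarith, by linarith⟩

lemma pullback_gap (h : RepellingSystem F φ K c C ρ) (hq : ∀ l, F^[l] q ∈ K)
    (hp : Pullback F q x η ρ n i Y R) {a : ℕ} (ha : i ≤ a) {s : ℝ} (hs : s ∈ uIoo (Y a) (R a))
    (k : ℕ) (hk : a + k ≤ n) : F^[k] s ∈ uIoo (Y (a + k)) (R (a + k)) := by
  induction k with
  | zero => exact hs
  | succ k ih =>
    have := h.map_uIoo (hq (a + k)) (h.left_near hp (by omega) (by omega))
      (hp.near (a + k) (by omega) (by omega)) (ih (by omega))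
    rwa [hp.map_left (a + k) (by omega) (by omega), hp.map_right (a + k) (by omega) (by omega),
      ← Function.iterate_succ_apply' F] at this

/-- At a time of closest approach to the top `x`, the pullbacks of `(x, x + η)` are disjoint. -/
lemma pullback_disjoint (h : RepellingSystem F φ K c C ρ) (hq : ∀ l, F^[l] q ∈ K)
    (hx : x ∈ K) (hη : 0 < η) (htop : ∀ l, F^[l] x ≤ x) (hqx : F^[n] q ≤ x)
    (hrec : ∀ l < n, F^[l] q < F^[n] q) (hp : Pullback F q x η ρ n i Y R) {j l : ℕ}
    (hj : i ≤ j) (hjl : j < l) (hl : l ≤ n) :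
    Disjoint (uIoo (Y j) (R j)) (uIoo (Y l) (R l)) := by
  rw [Set.disjoint_left]
  intro s hsj hsl
  obtain ⟨m, rfl⟩ := Nat.exists_eq_add_of_le hl
  obtain ⟨k, rfl⟩ := Nat.exists_eq_add_of_lt hjl
  have hst := h.pullback_gap hq hp hj hsj m (by omega)
  have hsn := h.pullback_gap hq hp (by omega) hsl m (by omega)
  rw [hp.left_eq, hp.right_eq, uIoo_of_le (by linarith)] at hsn
  set t := F^[m] s with ht
  obtain ⟨a, ha⟩ : ∃ a, a = j + m := ⟨_, rfl⟩
  rw [← ha] at hst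
  have hak : a + (k + 1) = j + k + 1 + m := by omega
  set w := F^[a] q with hw
  have htn := h.pullback_gap hq hp (by omega) hst (k + 1) (by omega)
  rw [hak, hp.left_eq, hp.right_eq, uIoo_of_le (by linarith)] at htn
  have hwn : F^[k + 1] w = F^[j + k + 1 + m] q := by
    rw [hw, ← Function.iterate_add_apply, add_comm, hak]
  have hwlt : w < F^[k + 1] w := by
    rw [hwn]
    exact hrec a (by omega)
  have hwx : w < x := by linarith
  have htI : t ∈ uIcc w (R a) :=
    uIcc_subset_uIcc (hp.mem a (by omega) (by omega)) right_mem_uIcc (uIoo_subset_uIcc_self hst)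
  have hsub : Icc w t ⊆ uIcc w (R a) := by
    rw [← uIcc_of_le (by linarith [hsn.1])]
    exact uIcc_subset_uIcc left_mem_uIcc htI
  have hcont := h.continuous.iterate (k + 1)
  have hmono : StrictMonoOn F^[k + 1] (Icc w t) := by
    rcases ContinuousOn.strictMonoOn_of_injOn_Icc' (by linarith [hsn.1]) hcont.continuousOn
      ((h.pullback_mapsTo_injOn hq hp (by omega) (k + 1) (by omega)).2.mono hsub) with hm | hm
    · exact hm
    · have := hm (left_mem_Icc.2 (by linarith [hsn.1])) (right_mem_Icc.2 (by linarith [hsn.1]))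
        (by linarith [hsn.1])
      linarith [htn.1]
  obtain ⟨p, hpI, hfix, hd⟩ := exists_fixedPt_abs_deriv_le_one hcont hwx.le
    (hmono.mono (Icc_subset_Icc_right hsn.1.le)) hwlt (htop _)
  obtain ⟨d, hd1, hd2⟩ := exists_hasDerivAt_iterate h.hasDerivAt (k + 1) p
  have := h.repelling p ⟨(h.subset (hq a)).1.trans hpI.1, hpI.2.trans (h.subset hx).2⟩ (k + 1)
    (by omega) hfix
  linarith [hd d hd1]

/-- A priori bounded pullbacks satisfy a better bound on the sum of their lengths. -/
lemma pullback_sum_le (h : RepellingSystem F φ K c C ρ) (hq : ∀ l, F^[l] q ∈ K)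
    (hx : x ∈ K) (hη : 0 < η) (htop : ∀ l, F^[l] x ≤ x) (hqx : F^[n] q ≤ x)
    (hrec : ∀ l < n, F^[l] q < F^[n] q) (hclose : Real.exp (C * 7) * (x - F^[n] q) ≤ η)
    (hp : Pullback F q x η ρ n i Y R) (hsum : ∑ l ∈ Finset.Icc i n, |R l - F^[l] q| ≤ 7) :
    ∑ l ∈ Finset.Icc i n, |R l - F^[l] q| ≤ 6 := by
  have hgap : ∑ l ∈ Finset.Icc i n, |R l - Y l| ≤ 3 := by
    have hbd : ∀ l ∈ Finset.Icc i n, ∀ u, |u - F^[l] q| ≤ ρ → u ∈ Icc (-1 : ℝ) 2 := by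
      intro l _ u hu
      have h1 := h.subset (hq l)
      have h2 := h.ρ_le_one
      rw [abs_le] at hu
      exact ⟨by linarith [h1.1], by linarith [h1.2]⟩
    refine sum_abs_sub_le_three _ Y R (fun l hl => ?_) (fun l hl => ?_) ?_
    · obtain ⟨h1, h2⟩ := Finset.mem_Icc.1 hl
      exact hbd l hl _ (h.left_near hp h1 h2)
    · obtain ⟨h1, h2⟩ := Finset.mem_Icc.1 hl
      exact hbd l hl _ (hp.near l h1 h2)
    · intro j hj l hl hjl
      obtain ⟨hj1, hj2⟩ := Finset.mem_Icc.1 hj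
      obtain ⟨hl1, hl2⟩ := Finset.mem_Icc.1 hl
      rcases lt_or_gt_of_ne hjl with hlt | hlt
      · exact h.pullback_disjoint hq hx hη htop hqx hrec hp hj1 hlt hl2
      · exact (h.pullback_disjoint hq hx hη htop hqx hrec hp hl1 hlt hj2).symm
  have hRn : |R n - Y n| = η := by rw [hp.left_eq, hp.right_eq, add_sub_cancel_left, abs_of_pos hη]
  have hYn : |Y n - F^[n] q| = x - F^[n] q := by rw [hp.left_eq, abs_of_nonneg (by linarith)]
  have hpos : ∀ l, i ≤ l → l ≤ n → 0 < |R l - Y l| := by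
    intro l h1 h2
    rw [abs_pos, sub_ne_zero]
    intro e
    have : ∀ m, l ≤ m → m ≤ n → R m = Y m := by
      intro m hm
      induction m, hm using Nat.le_induction with
      | base => exact fun _ => e
      | succ m hm ih =>
        intro h3
        rw [← hp.map_right m (by omega) (by omega), ← hp.map_left m (by omega) (by omega),
          ih (by omega)]
    rw [this n h2 le_rfl, sub_self, abs_zero] at hRn
    linarith
  have hcmp : ∀ l ∈ Finset.Icc i n, |Y l - F^[l] q| ≤ |R l - Y l| := by
    intro l hl
    obtain ⟨h1, h2⟩ := Finset.mem_Icc.1 hl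
    have ht := ratio_telescope (a := fun m => |Y m - F^[m] q|) (b := fun m => |R m - Y m|)
      (w := fun m => |R m - F^[m] q|) (i := l) (n := n) (C := C)
      (fun m h3 h4 => hpos m (by omega) h4) (fun m h3 h4 => by
        have := h.ratio_step (hq m) (hp.near m (by omega) h4.le) right_mem_uIcc
          (hp.mem m (by omega) h4.le) (hp.mem m (by omega) h4.le) left_mem_uIcc
        rw [hp.map_right m (by omega) h4, hp.map_left m (by omega) h4,
          ← Function.iterate_succ_apply' F] at this
        linarith) h2
    simp only [hRn, hYn] at ht
    have hsum' : ∑ m ∈ Finset.Ico l n, |R m - F^[m] q| ≤ 7 :=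
      (Finset.sum_le_sum_of_subset_of_nonneg (fun m hm => by
        rw [Finset.mem_Ico] at hm
        rw [Finset.mem_Icc]
        omega) fun _ _ _ => abs_nonneg _).trans hsum
    have hE : Real.exp (C * ∑ m ∈ Finset.Ico l n, |R m - F^[m] q|) ≤ Real.exp (C * 7) :=
      Real.exp_le_exp.2 (mul_le_mul_of_nonneg_left hsum' h.C_nonneg)
    refine le_of_mul_le_mul_right (ht.trans ?_) hη
    calc Real.exp (C * ∑ m ∈ Finset.Ico l n, |R m - F^[m] q|) * ((x - F^[n] q) * |R l - Y l|)
        ≤ Real.exp (C * 7) * ((x - F^[n] q) * |R l - Y l|) :=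
          mul_le_mul_of_nonneg_right hE (mul_nonneg (by linarith) (abs_nonneg _))
      _ = (Real.exp (C * 7) * (x - F^[n] q)) * |R l - Y l| := by ring
      _ ≤ η * |R l - Y l| := mul_le_mul_of_nonneg_right hclose (abs_nonneg _)
      _ = _ := mul_comm _ _
  calc ∑ l ∈ Finset.Icc i n, |R l - F^[l] q|
      ≤ ∑ l ∈ Finset.Icc i n, 2 * |R l - Y l| := by
        refine Finset.sum_le_sum fun l hl => ?_
        have := abs_sub_le (R l) (Y l) (F^[l] q)
        linarith [hcmp l hl]
    _ ≤ 6 := by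
        rw [← Finset.mul_sum]
        linarith

/-- Lengths of pullbacks are comparable to derivatives along the orbit. -/
lemma pullback_comparable (h : RepellingSystem F φ K c C ρ) (hq : ∀ l, F^[l] q ∈ K)
    (hp : Pullback F q x η ρ n i Y R) (hsum : ∑ l ∈ Finset.Icc i n, |R l - F^[l] q| ≤ 7)
    {k : ℕ} (hk : i + k ≤ n) :
    orbitProd F φ k (F^[i] q) * |R i - F^[i] q| ≤
        Real.exp (C * 7) * |R (i + k) - F^[i + k] q| ∧
      |R (i + k) - F^[i + k] q| ≤
        Real.exp (C * 7) * (orbitProd F φ k (F^[i] q) * |R i - F^[i] q|) := by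
  set E : ℕ → ℝ := fun k => Real.exp (C * ∑ l ∈ Finset.Ico i (i + k), |R l - F^[l] q|) with hE
  have hE7 : E k ≤ Real.exp (C * 7) := by
    refine Real.exp_le_exp.2 (mul_le_mul_of_nonneg_left ?_ h.C_nonneg)
    refine (Finset.sum_le_sum_of_subset_of_nonneg (fun m hm => ?_)
      fun _ _ _ => abs_nonneg _).trans hsum
    rw [Finset.mem_Ico] at hm
    rw [Finset.mem_Icc]
    omega
  have key : orbitProd F φ k (F^[i] q) * |R i - F^[i] q| ≤ E k * |R (i + k) - F^[i + k] q| ∧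
      |R (i + k) - F^[i + k] q| ≤ E k * (orbitProd F φ k (F^[i] q) * |R i - F^[i] q|) := by
    clear hE7
    induction k with
    | zero => simp [hE, orbitProd_zero]
    | succ k ih =>
      obtain ⟨ih1, ih2⟩ := ih (by omega)
      have hnear := hp.near (i + k) (by omega) (by omega)
      have hself : |F^[i + k] q - F^[i + k] q| ≤ ρ := by simp [h.ρ_pos.le]
      obtain ⟨ξ, hξ, e⟩ := h.exists_slope (R (i + k)) (F^[i + k] q)
      rw [hp.map_right (i + k) (by omega) (by omega), ← Function.iterate_succ_apply' F] at e
      have hξ' := ball_convex hnear hself hξ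
      have hle : |F^[i + k] q - ξ| ≤ |R (i + k) - F^[i + k] q| := by
        rw [abs_sub_comm (R (i + k))]
        exact abs_sub_le_of_uIcc_subset_uIcc (uIcc_subset_uIcc_right hξ)
      have hexp : Real.exp (C * |F^[i + k] q - ξ|) ≤ Real.exp (C * |R (i + k) - F^[i + k] q|) :=
        Real.exp_le_exp.2 (mul_le_mul_of_nonneg_left hle h.C_nonneg)
      have d1 := (h.distortion _ (hq (i + k)) _ _ hself hξ').trans
        (mul_le_mul_of_nonneg_right hexp (abs_nonneg _))
      have d2 := (h.distortion _ (hq (i + k)) _ _ hξ' hself)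
      rw [abs_sub_comm ξ] at d2
      replace d2 := d2.trans (mul_le_mul_of_nonneg_right hexp (abs_nonneg _))
      have hE_succ : E (k + 1) = E k * Real.exp (C * |R (i + k) - F^[i + k] q|) := by
        simp only [hE]
        rw [← add_assoc, Finset.sum_Ico_succ_top (by omega), mul_add, Real.exp_add]
      have hEk : 0 ≤ E k := (Real.exp_pos _).le
      have hPk := orbitProd_nonneg F φ k (F^[i] q)
      have hit : F^[k] (F^[i] q) = F^[i + k] q := by
        rw [← Function.iterate_add_apply, add_comm]
      rw [← add_assoc, e, abs_mul, orbitProd_succ, hE_succ, hit]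
      constructor
      · calc orbitProd F φ k (F^[i] q) * |φ (F^[i + k] q)| * |R i - F^[i] q|
            = (orbitProd F φ k (F^[i] q) * |R i - F^[i] q|) * |φ (F^[i + k] q)| := by ring
          _ ≤ (E k * |R (i + k) - F^[i + k] q|) *
              (Real.exp (C * |R (i + k) - F^[i + k] q|) * |φ ξ|) :=
              mul_le_mul ih1 d1 (abs_nonneg _) (by positivity)
          _ = _ := by ring
      · calc |φ ξ| * |R (i + k) - F^[i + k] q|
            ≤ (Real.exp (C * |R (i + k) - F^[i + k] q|) * |φ (F^[i + k] q)|) *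
              (E k * (orbitProd F φ k (F^[i] q) * |R i - F^[i] q|)) :=
              mul_le_mul d2 ih2 (abs_nonneg _) (by positivity)
          _ = _ := by ring
  refine ⟨key.1.trans (mul_le_mul_of_nonneg_right hE7 (abs_nonneg _)),
    key.2.trans (mul_le_mul_of_nonneg_right hE7 ?_)⟩
  exact mul_nonneg (orbitProd_nonneg _ _ _ _) (abs_nonneg _)

lemma pullback_sum_orbitProd_le (h : RepellingSystem F φ K c C ρ) (hq : ∀ l, F^[l] q ∈ K)
    (hp : Pullback F q x η ρ n i Y R) (hsum : ∑ l ∈ Finset.Icc i n, |R l - F^[l] q| ≤ 6) :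
    (∑ k ∈ Finset.range (n + 1 - i), orbitProd F φ k (F^[i] q)) * |R i - F^[i] q| ≤
      6 * Real.exp (C * 7) := by
  rw [Finset.sum_mul]
  calc ∑ k ∈ Finset.range (n + 1 - i), orbitProd F φ k (F^[i] q) * |R i - F^[i] q|
      ≤ ∑ k ∈ Finset.range (n + 1 - i), Real.exp (C * 7) * |R (i + k) - F^[i + k] q| :=
        Finset.sum_le_sum fun k hk =>
          (h.pullback_comparable hq hp (by linarith) (by rw [Finset.mem_range] at hk; omega)).1
    _ = Real.exp (C * 7) * ∑ l ∈ Finset.Icc i n, |R l - F^[l] q| := by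
        rw [← Finset.mul_sum, ← Finset.Ico_add_one_right_eq_Icc, Finset.sum_Ico_eq_sum_range]
    _ ≤ 6 * Real.exp (C * 7) := by
        rw [mul_comm]
        exact mul_le_mul_of_nonneg_right hsum (Real.exp_pos _).le

lemma pullback_length_le (h : RepellingSystem F φ K c C ρ) (hq : ∀ l, F^[l] q ∈ K)
    (hp : Pullback F q x η ρ n i Y R) : c ^ (n - i) * |R i - F^[i] q| ≤ |R n - F^[n] q| := by
  have key : ∀ k, i + k ≤ n → c ^ k * |R i - F^[i] q| ≤ |R (i + k) - F^[i + k] q| := by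
    intro k
    induction k with
    | zero => simp
    | succ k ih =>
      intro hk
      have h1 := h.expand (hq (i + k)) (hp.near (i + k) (by omega) (by omega))
        (v := F^[i + k] q) (by simp [h.ρ_pos.le])
      rw [hp.map_right (i + k) (by omega) (by omega), ← Function.iterate_succ_apply' F] at h1
      refine le_trans ?_ h1
      rw [pow_succ, mul_comm (c ^ k), mul_assoc]
      exact mul_le_mul_of_nonneg_left (ih (by omega)) h.c_pos.le
  have := key (n - i) (by have := hp.le; omega)
  rwa [Nat.add_sub_cancel' hp.le] at this

/-- A pullback can be extended one step further as long as it is short. -/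
lemma pullback_extend (h : RepellingSystem F φ K c C ρ) (hq : ∀ l, F^[l] q ∈ K)
    (hp : Pullback F q x η ρ n (i + 1) Y R) (hshort : |R (i + 1) - F^[i + 1] q| ≤ c * ρ) :
    ∃ Y' R', Pullback F q x η ρ n i Y' R' ∧ ∑ l ∈ Finset.Icc i n, |R' l - F^[l] q| ≤
      ρ + ∑ l ∈ Finset.Icc (i + 1) n, |R l - F^[l] q| := by
  have hin : i + 1 ≤ n := hp.le
  rw [Function.iterate_succ_apply'] at hshort
  obtain ⟨r, hr, hFr⟩ := h.exists_preimage (hq i) hshort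
  obtain ⟨y, hy, hFy⟩ : ∃ y ∈ uIcc (F^[i] q) r, F y = Y (i + 1) := by
    have hm := hp.mem (i + 1) le_rfl hin
    rw [Function.iterate_succ_apply', ← hFr] at hm
    exact intermediate_value_uIcc h.continuous.continuousOn hm
  have hup : ∀ (Z : ℕ → ℝ) (z : ℝ) (l : ℕ), i + 1 ≤ l → Function.update Z i z l = Z l :=
    fun Z z l hl => Function.update_of_ne (by omega) _ _
  refine ⟨Function.update Y i y, Function.update R i r, ⟨by omega, ?_, ?_, ?_, ?_, ?_, ?_⟩, ?_⟩
  · intro l h1 h2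
    rcases h1.eq_or_lt with rfl | h1
    · rw [Function.update_self, hup _ _ _ le_rfl, hFy]
    · rw [hup _ _ _ h1, hup _ _ _ (by omega), hp.map_left l h1 h2]
  · intro l h1 h2
    rcases h1.eq_or_lt with rfl | h1
    · rw [Function.update_self, hup _ _ _ le_rfl, hFr]
    · rw [hup _ _ _ h1, hup _ _ _ (by omega), hp.map_right l h1 h2]
  · intro l h1 h2
    rcases h1.eq_or_lt with rfl | h1
    · rwa [Function.update_self]
    · rw [hup _ _ _ h1]
      exact hp.near l h1 h2
  · intro l h1 h2
    rcases h1.eq_or_lt with rfl | h1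
    · rwa [Function.update_self, Function.update_self]
    · rw [hup _ _ _ h1, hup _ _ _ h1]
      exact hp.mem l h1 h2
  · rw [hup _ _ _ hin, hp.left_eq]
  · rw [hup _ _ _ hin, hp.right_eq]
  · rw [← Finset.insert_Icc_add_one_left_eq_Icc (by omega : i ≤ n),
      Finset.sum_insert (by simp), Function.update_self]
    refine add_le_add hr (Finset.sum_congr rfl fun l hl => ?_).le
    rw [hup _ _ _ (Finset.mem_Icc.1 hl).1]

lemma exists_pullback (h : RepellingSystem F φ K c C ρ) (hq : ∀ l, F^[l] q ∈ K)
    (hx : x ∈ K) (hη : 0 < η) (htop : ∀ l, F^[l] x ≤ x) (hqx : F^[n] q ≤ x)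
    (hrec : ∀ l < n, F^[l] q < F^[n] q) (hclose : Real.exp (C * 7) * (x - F^[n] q) ≤ η)
    {N : ℕ} (hN : ∀ l, 6 * Real.exp (C * 7) / (c * ρ) <
      ∑ k ∈ Finset.range N, orbitProd F φ k (F^[l] q))
    (hηN : 2 * η ≤ c ^ N * (c * ρ)) :
    ∃ Y R, Pullback F q x η ρ n 0 Y R ∧ ∑ l ∈ Finset.Icc 0 n, |R l - F^[l] q| ≤ 6 := by
  have hc := h.c_pos
  have hc1 := h.c_le_one
  have hρ := h.ρ_pos
  have hρ1 := h.ρ_le_one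
  have hcρ : 0 < c * ρ := mul_pos hc hρ
  have hcρ1 : c * ρ ≤ ρ := mul_le_of_le_one_left hρ.le hc1
  have hη2 : 2 * η ≤ c * ρ := hηN.trans (mul_le_of_le_one_left hcρ.le (pow_le_one₀ hc.le hc1))
  have hxq : x - F^[n] q ≤ η :=
    (le_mul_of_one_le_left (by linarith)
      (Real.one_le_exp (mul_nonneg h.C_nonneg (by norm_num)))).trans hclose
  have hlast : |x + η - F^[n] q| ≤ 2 * η := by
    rw [abs_of_nonneg (by linarith)]
    linarith
  have key : ∀ k i, i + k = n → ∃ Y R, Pullback F q x η ρ n i Y R ∧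
      ∑ l ∈ Finset.Icc i n, |R l - F^[l] q| ≤ 6 := by
    intro k
    induction k with
    | zero =>
      rintro i rfl
      refine ⟨fun _ => x, fun _ => x + η, ⟨le_rfl, by intros; omega, by intros; omega, ?_, ?_,
        rfl, rfl⟩, ?_⟩
      · intro l h1 h2
        obtain rfl : l = i := le_antisymm h2 h1
        exact hlast.trans (hη2.trans hcρ1)
      · intro l h1 h2
        obtain rfl : l = i := le_antisymm h2 h1
        exact mem_uIcc.2 (Or.inl ⟨hqx, by linarith⟩)
      · simp only [add_zero, Finset.Icc_self, Finset.sum_singleton] at hlast ⊢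
        linarith
    | succ k ih =>
      intro i hi
      obtain ⟨Y, R, hp, hs⟩ := ih (i + 1) (by omega)
      have hshort : |R (i + 1) - F^[i + 1] q| ≤ c * ρ := by
        by_contra! hlong
        have h1 := h.pullback_sum_orbitProd_le hq hp hs
        have h2 : ∑ j ∈ Finset.range (n + 1 - (i + 1)), orbitProd F φ j (F^[i + 1] q) ≤
            6 * Real.exp (C * 7) / (c * ρ) := by
          rw [le_div_iff₀ hcρ]
          exact (mul_le_mul_of_nonneg_left hlong.le
            (Finset.sum_nonneg fun _ _ => orbitProd_nonneg _ _ _ _)).trans h1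
        have h3 : n + 1 - (i + 1) ≤ N := by
          by_contra! hcon
          have := Finset.sum_le_sum_of_subset_of_nonneg (Finset.range_mono hcon.le)
            fun j _ _ => orbitProd_nonneg F φ j (F^[i + 1] q)
          linarith [hN (i + 1)]
        have h4 := h.pullback_length_le hq hp
        rw [hp.right_eq] at h4
        have h5 : c ^ N ≤ c ^ (n - (i + 1)) := pow_le_pow_of_le_one hc.le hc1 (by omega)
        have h6 : c ^ N * (c * ρ) < c ^ (n - (i + 1)) * |R (i + 1) - F^[i + 1] q| :=
          mul_lt_mul' h5 hlong hcρ.le (pow_pos hc _)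
        linarith
      obtain ⟨Y', R', hp', hs'⟩ := h.pullback_extend hq hp hshort
      exact ⟨Y', R', hp', h.pullback_sum_le hq hx hη htop hqx hrec hclose hp' (by linarith)⟩
  exact key n 0 (zero_add n)

/-- An orbit with bounded derivatives in a minimal set with maximum `x` cannot avoid `x`. -/
lemma not_bounded_of_minimal (h : RepellingSystem F φ K c C ρ) {M : Set ℝ} (hMc : IsClosed M)
    (hMK : M ⊆ K) (hMF : MapsTo F M M)
    (hmin : ∀ q ∈ M, ∀ B, (∀ n, orbitProd F φ n q ≤ B) →
      ∀ k : ℕ, M ⊆ closure ((fun i => F^[i] q) '' Ici k))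
    (hx : IsGreatest M x) (hqM : q ∈ M) (hne : ∀ i, F^[i] q ≠ x) {B : ℝ}
    (hB : ∀ n, orbitProd F φ n q ≤ B) : False := by
  have hc := h.c_pos
  have hρ := h.ρ_pos
  have hM : ∀ y ∈ M, ∀ i, F^[i] y ∈ M := fun y hy i => hMF.iterate i hy
  have hB1 : 1 ≤ B := by simpa [orbitProd_zero] using hB 0
  have hD := Real.exp_pos (C * 7)
  set D := Real.exp (C * 7)
  obtain ⟨N, hN⟩ := h.exists_lt_sum hMc hMK hMF hmin (6 * D / (c * ρ))
  obtain ⟨η, hη, hηN⟩ : ∃ η > 0, 2 * η ≤ c ^ N * (c * ρ) :=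
    ⟨c ^ N * (c * ρ) / 2, by positivity, by linarith⟩
  obtain ⟨N', hN'⟩ := h.exists_lt_sum hMc hMK hMF hmin (6 * D * (D * B) / η)
  have hlt : ∀ i, F^[i] q < x := fun i => lt_of_le_of_ne (hx.2 (hM q hqM i)) (hne i)
  obtain ⟨t, htx, htη, ht⟩ : ∃ t < x, x - η / D ≤ t ∧ ∀ i < N', F^[i] q ≤ t := by
    clear hN'
    induction N' with
    | zero => exact ⟨x - η / D, by linarith [div_pos hη hD], le_rfl, by simp⟩
    | succ m ih =>
      obtain ⟨t, h1, h2, h3⟩ := ih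
      refine ⟨max t (F^[m] q), max_lt h1 (hlt m), h2.trans (le_max_left _ _), fun i hi => ?_⟩
      rcases Nat.lt_succ_iff_lt_or_eq.1 hi with hi | rfl
      · exact (h3 i hi).trans (le_max_left _ _)
      · exact le_max_right _ _
  have hex : ∃ i, t < F^[i] q := by
    obtain ⟨-, ⟨i, -, rfl⟩, hi⟩ := Metric.mem_closure_iff.1 (hmin q hqM B hB 0 hx.1) (x - t)
      (by linarith)
    rw [Real.dist_eq, abs_lt] at hi
    exact ⟨i, by linarith [hi.2]⟩
  classical
  obtain ⟨n, hn, hmin_n⟩ : ∃ n, t < F^[n] q ∧ ∀ l < n, F^[l] q ≤ t :=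
    ⟨Nat.find hex, Nat.find_spec hex, fun l hl => not_lt.1 (Nat.find_min hex hl)⟩
  have hnN : N' ≤ n := by
    by_contra! hcon
    linarith [ht n hcon]
  have hclose : D * (x - F^[n] q) ≤ η := by
    rw [mul_comm, ← le_div_iff₀ hD]
    linarith
  have hqK : ∀ l, F^[l] q ∈ K := fun l => hMK (hM q hqM l)
  obtain ⟨Y, R, hp, hs⟩ := h.exists_pullback hqK (hMK hx.1) hη (fun l => hx.2 (hM x hx.1 l))
    (hlt n).le (fun l hl => (hmin_n l hl).trans_lt hn) hclose (fun l => hN _ (hM q hqM l)) hηN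
  have h1 := h.pullback_sum_orbitProd_le hqK hp hs
  have h2 := (h.pullback_comparable hqK hp (by linarith) (k := n) (by omega)).2
  simp only [zero_add, tsub_zero, Function.iterate_zero, id] at h1 h2
  rw [hp.right_eq, abs_of_pos (by linarith [hlt n])] at h2
  have h3 : η ≤ D * B * |R 0 - q| := by
    have : orbitProd F φ n q * |R 0 - q| ≤ B * |R 0 - q| :=
      mul_le_mul_of_nonneg_right (hB n) (abs_nonneg _)
    have := mul_le_mul_of_nonneg_left this hD.le
    linarith [hlt n]
  have h4 : 6 * D * (D * B) / η < ∑ k ∈ Finset.range (n + 1), orbitProd F φ k q :=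
    (hN' q hqM).trans_le (Finset.sum_le_sum_of_subset_of_nonneg
      (Finset.range_mono (by omega)) fun j _ _ => orbitProd_nonneg F φ j q)
  rw [div_lt_iff₀ hη] at h4
  have hS : 0 ≤ ∑ k ∈ Finset.range (n + 1), orbitProd F φ k q :=
    Finset.sum_nonneg fun j _ => orbitProd_nonneg F φ j q
  have h5 := mul_le_mul_of_nonneg_left h3 hS
  have h6 := mul_le_mul_of_nonneg_left h1 (show 0 ≤ D * B by positivity)
  linarith

lemma exists_one_lt_orbitProd (h : RepellingSystem F φ K c C ρ) (hx : ∀ i, F^[i] x ∈ K) :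
    ∃ n, 1 < orbitProd F φ n x := by
  by_contra! hcon
  obtain ⟨M, hMc, hMK, hMF, ⟨y, hyM, hy⟩, hmin⟩ := h.exists_minimal hx hcon
  obtain ⟨z, hz⟩ := (h.isCompact.of_isClosed_subset hMc hMK).exists_isGreatest ⟨y, hyM⟩
  by_cases hyz : ∀ i, F^[i] y ≠ z
  · exact h.not_bounded_of_minimal hMc hMK hMF hmin hz hyM hyz hy
  push Not at hyz
  obtain ⟨k, rfl⟩ := hyz
  have hzK : ∀ i, F^[i] (F^[k] y) ∈ K := fun i => hMK (hMF.iterate i hz.1)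
  have hpos : 0 < orbitProd F φ k y := h.orbitProd_pos fun i _ => hMK (hMF.iterate i hyM)
  have hb : ∀ n, orbitProd F φ n (F^[k] y) ≤ 1 / orbitProd F φ k y := by
    intro n
    rw [le_div_iff₀ hpos, mul_comm, ← orbitProd_add]
    exact hy _
  have hpos' : 0 < orbitProd F φ 1 (F^[k] y) := h.orbitProd_pos fun i _ => hzK i
  refine h.not_bounded_of_minimal hMc hMK hMF hmin hz (hMF hz.1)
    (B := 1 / orbitProd F φ k y / orbitProd F φ 1 (F^[k] y)) (fun i => ?_) fun n => ?_
  · rw [← Function.iterate_succ_apply]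
    exact h.iterate_ne_of_bounded (h.subset (hzK 0)) hb (by omega)
  · rw [le_div_iff₀ hpos', mul_comm]
    have := orbitProd_add F φ 1 n (F^[k] y)
    rw [Function.iterate_one] at this
    rw [← this]
    exact hb _

lemma exists_uniform_time (h : RepellingSystem F φ K c C ρ) :
    ∃ k : ℕ, ∃ L : ℝ, 1 < L ∧ ∀ x, (∀ i ≤ k, F^[i] x ∈ K) →
      ∃ n ≤ k + 1, L < orbitProd F φ n x := by
  by_contra! hcon
  set A : ℕ → Set ℝ := fun k => {x | ∀ i ≤ k, F^[i] x ∈ K} ∩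
    {x | ∀ n ≤ k + 1, orbitProd F φ n x ≤ 1 + 1 / ((k : ℝ) + 1)} with hA
  have hclosed : ∀ k, IsClosed (A k) := by
    intro k
    simp only [hA, ofPred_forall]
    exact (isClosed_iInter fun i => isClosed_iInter fun _ =>
      h.isCompact.isClosed.preimage (h.continuous.iterate i)).inter
      (isClosed_iInter fun n => isClosed_iInter fun _ =>
        isClosed_le (h.continuous_orbitProd n) continuous_const)
  obtain ⟨x, hx⟩ := IsCompact.nonempty_iInter_of_sequence_nonempty_isCompact_isClosed A
    (fun k x hx => ⟨fun i hi => hx.1 i (by omega), fun n hn => (hx.2 n (by omega)).trans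
      (add_le_add_right (Nat.one_div_le_one_div (Nat.le_succ k)) 1)⟩)
    (fun k => by
      obtain ⟨x, h1, h2⟩ := hcon k (1 + 1 / ((k : ℝ) + 1)) (by
        have : 0 < 1 / ((k : ℝ) + 1) := Nat.one_div_pos_of_nat
        linarith)
      exact ⟨x, h1, h2⟩)
    (h.isCompact.of_isClosed_subset (hclosed 0) fun x hx => hx.1 0 le_rfl) hclosed
  rw [mem_iInter] at hx
  obtain ⟨n, hn⟩ := h.exists_one_lt_orbitProd fun i => (hx i).1 i le_rfl
  obtain ⟨k, hk⟩ := exists_nat_one_div_lt (sub_pos.2 hn)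
  have h1 := (hx (max k n)).2 n (by omega)
  have h2 := Nat.one_div_le_one_div (α := ℝ) (le_max_left k n)
  linarith

lemma exists_uniform_expansion (h : RepellingSystem F φ K c C ρ) :
    ∃ C' : ℝ, 0 < C' ∧ ∃ lam : ℝ, 1 < lam ∧ ∀ n x, (∀ i < n, F^[i] x ∈ K) →
      C' * lam ^ n ≤ orbitProd F φ n x := by
  obtain ⟨k, L, hL, hk⟩ := h.exists_uniform_time
  have hc := h.c_pos
  have hc1 := h.c_le_one
  have hL0 : 0 < L := by linarith
  set lam : ℝ := L ^ (((k + 1 : ℕ) : ℝ)⁻¹) with hlam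
  have hlam1 : 1 < lam := Real.one_lt_rpow hL (by positivity)
  have hpow : lam ^ (k + 1) = L := Real.rpow_inv_natCast_pow hL0.le (by omega)
  have hle : ∀ n ≤ k + 1, lam ^ n ≤ L := fun n hn =>
    (pow_le_pow_right₀ hlam1.le hn).trans hpow.le
  refine ⟨c ^ (k + 1) / L, by positivity, lam, hlam1, fun n => ?_⟩
  induction n using Nat.strong_induction_on with
  | _ n ih =>
    intro x hx
    rcases le_or_gt n k with hn | hn
    · have h1 : c ^ n ≤ orbitProd F φ n x := by
        rw [orbitProd]
        conv_lhs => rw [← Finset.card_range n, ← Finset.prod_const]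
        exact Finset.prod_le_prod (fun _ _ => hc.le) fun i hi =>
          h.lower _ (hx i (Finset.mem_range.1 hi)) _ (by simp [h.ρ_pos.le])
      calc c ^ (k + 1) / L * lam ^ n ≤ c ^ (k + 1) / L * L :=
            mul_le_mul_of_nonneg_left (hle n (by omega)) (by positivity)
        _ = c ^ (k + 1) := div_mul_cancel₀ _ hL0.ne'
        _ ≤ c ^ n := pow_le_pow_of_le_one hc.le hc1 (by omega)
        _ ≤ _ := h1
    · obtain ⟨j, hj, hjL⟩ := hk x fun i hi => hx i (by omega)
      have hj0 : j ≠ 0 := by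
        rintro rfl
        rw [orbitProd_zero] at hjL
        linarith
      obtain ⟨m, rfl⟩ := Nat.exists_eq_add_of_le (show j ≤ n by omega)
      have h1 := ih m (by omega) (F^[j] x) fun i hi => by
        rw [← Function.iterate_add_apply, add_comm]
        exact hx _ (by omega)
      rw [orbitProd_add, pow_add lam]
      calc c ^ (k + 1) / L * (lam ^ j * lam ^ m) = lam ^ j * (c ^ (k + 1) / L * lam ^ m) := by ring
        _ ≤ _ := mul_le_mul ((hle j hj).trans hjL.le) h1 (by positivity) (orbitProd_nonneg _ _ _ _)

end RepellingSystem

/-- Away from its critical points, a `C²` map of `[0, 1]` with repelling periodic points coincides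
with a `RepellingSystem`. -/
lemma exists_repellingSystem {f : ℝ → ℝ} (hC2 : ContDiffOn ℝ 2 f (Icc 0 1))
    (hmaps : MapsTo f (Icc 0 1) (Icc 0 1))
    (hrep : ∀ x ∈ Icc (0 : ℝ) 1, ∀ n : ℕ, 1 ≤ n → f^[n] x = x → 1 < |deriv (f^[n]) x|)
    {K : Set ℝ} (hK : IsCompact K) (hKI : K ⊆ Icc 0 1) (hne : ∀ x ∈ K, deriv f x ≠ 0) :
    ∃ F φ c C ρ, RepellingSystem F φ K c C ρ ∧ EqOn F f (Icc 0 1) ∧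
      ∀ x ∈ Icc (0 : ℝ) 1, ∀ n, DifferentiableAt ℝ f^[n] x →
        |deriv f^[n] x| = orbitProd F φ n x := by
  have hu : UniqueDiffOn ℝ (Icc (0 : ℝ) 1) := uniqueDiffOn_Icc zero_lt_one
  set g : ℝ → ℝ := derivWithin f (Icc 0 1) with hg
  have hg1 : ContDiffOn ℝ 1 g (Icc 0 1) := hC2.derivWithin hu (by norm_num)
  obtain ⟨M, hM⟩ := hg1.exists_lipschitzOnWith one_ne_zero (convex_Icc 0 1) isCompact_Icc
  set φ : ℝ → ℝ := fun x => g (projIcc 0 1 zero_le_one x) with hφ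
  have hφg : ∀ x ∈ Icc (0 : ℝ) 1, φ x = g x := fun x hx => by
    simp only [hφ, projIcc_of_mem _ hx]
  have hφL : ∀ u v, |φ u - φ v| ≤ M * |u - v| := by
    intro u v
    have h1 := hM.dist_le_mul _ (projIcc (0 : ℝ) 1 zero_le_one u).2 _
      (projIcc (0 : ℝ) 1 zero_le_one v).2
    have h2 := (LipschitzWith.projIcc (zero_le_one' ℝ)).dist_le_mul u v
    rw [NNReal.coe_one, one_mul, Subtype.dist_eq] at h2
    exact h1.trans (mul_le_mul_of_nonneg_left h2 M.2)
  have hφc : Continuous φ := by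
    refine (LipschitzWith.of_dist_le_mul (K := M) fun u v => ?_).continuous
    exact hφL u v
  set F : ℝ → ℝ := fun x => f 0 + ∫ t in (0 : ℝ)..x, φ t with hF
  have hFd : ∀ x, HasDerivAt F (φ x) x := fun x =>
    (intervalIntegral.integral_hasDerivAt_right (hφc.intervalIntegrable _ _)
      (hφc.stronglyMeasurableAtFilter _ _) hφc.continuousAt).const_add _
  have hfd : ∀ x ∈ Icc (0 : ℝ) 1, HasDerivWithinAt f (g x) (Icc 0 1) x := fun x hx =>
    (hC2.differentiableOn two_ne_zero x hx).hasDerivWithinAt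
  have hEq : EqOn F f (Icc 0 1) := by
    intro x hx
    have : ∫ t in (0 : ℝ)..x, φ t = f x - f 0 := by
      refine intervalIntegral.integral_eq_sub_of_hasDeriv_right_of_le hx.1
        (hC2.continuousOn.mono (Icc_subset_Icc_right hx.2)) (fun t ht => ?_)
        (hφc.intervalIntegrable _ _)
      have ht' : t ∈ Ioo (0 : ℝ) 1 := ⟨ht.1, ht.2.trans_le hx.2⟩
      rw [hφg t (Ioo_subset_Icc_self ht')]
      exact ((hfd t (Ioo_subset_Icc_self ht')).hasDerivAt
        (Icc_mem_nhds ht'.1 ht'.2)).hasDerivWithinAt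
    simp only [hF, this]
    ring
  have hFI : MapsTo F (Icc 0 1) (Icc 0 1) := fun x hx => by
    rw [hEq hx]
    exact hmaps hx
  have hit : ∀ n, EqOn F^[n] f^[n] (Icc 0 1) := by
    intro n
    induction n with
    | zero => exact fun x _ => rfl
    | succ n ih =>
      intro x hx
      rw [Function.iterate_succ_apply, Function.iterate_succ_apply, hEq hx, ih (hmaps hx)]
  have hderiv : ∀ x ∈ Icc (0 : ℝ) 1, ∀ n, DifferentiableAt ℝ f^[n] x →
      |deriv f^[n] x| = orbitProd F φ n x := by
    intro x hx n hd
    obtain ⟨d, hd1, hd2⟩ := exists_hasDerivAt_iterate hFd n x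
    rw [← hd2]
    congr 1
    exact (hu x hx).eq_deriv _ hd.hasDerivAt.hasDerivWithinAt
      (hd1.hasDerivWithinAt.congr (fun y hy => (hit n hy).symm) (hit n hx).symm)
  have hφK : ∀ x ∈ K, 0 < |φ x| := by
    intro x hx
    have := hderiv x (hKI hx) 1 (differentiableAt_of_deriv_ne_zero (hne x hx))
    simp only [Function.iterate_one, orbitProd, Finset.prod_range_one, Function.iterate_zero,
      id] at this
    rw [← this]
    exact abs_pos.2 (hne x hx)
  obtain ⟨c₀, hc₀, hlow⟩ := hK.exists_forall_le' hφc.abs.continuousOn hφK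
  have hM0 : (0 : ℝ) ≤ M := M.2
  have hc : 0 < min 1 (c₀ / 2) := by positivity
  set ρ : ℝ := min 1 (c₀ / (2 * (M + 1))) with hρ
  have hρ0 : 0 < ρ := by positivity
  have hMρ : M * ρ ≤ c₀ / 2 := by
    calc (M : ℝ) * ρ ≤ (M + 1) * (c₀ / (2 * (M + 1))) :=
          mul_le_mul (by linarith) (min_le_right _ _) hρ0.le (by linarith)
      _ = c₀ / 2 := by field_simp
  have hlower : ∀ q ∈ K, ∀ u, |u - q| ≤ ρ → min 1 (c₀ / 2) ≤ |φ u| := by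
    intro q hq u hqu
    refine (min_le_right _ _).trans ?_
    have h1 := hφL q u
    have h2 := abs_sub_abs_le_abs_sub (φ q) (φ u)
    have h3 : M * |q - u| ≤ M * ρ := by
      rw [abs_sub_comm]
      exact mul_le_mul_of_nonneg_left hqu hM0
    linarith [hlow q hq]
  refine ⟨F, φ, min 1 (c₀ / 2), M / min 1 (c₀ / 2), ρ, ⟨hFd, hφc, hFI, ?_, hK, hKI, hc,
    min_le_left _ _, by positivity, hρ0, min_le_left _ _, hlower, ?_⟩, hEq, hderiv⟩
  · intro x hx n hn hfix
    rw [hit n hx] at hfix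
    have h1 := hrep x hx n hn hfix
    rwa [hderiv x hx n (differentiableAt_of_deriv_ne_zero (abs_pos.1 (by linarith)))] at h1
  · intro q hq u v hqu hqv
    set c := min 1 (c₀ / 2) with hcdef
    have h1 := hφL u v
    have h2 := abs_sub_abs_le_abs_sub (φ u) (φ v)
    have h3 : M * |u - v| ≤ M / c * |u - v| * |φ v| := by
      calc M * |u - v| = M / c * |u - v| * c := by field_simp
        _ ≤ _ := mul_le_mul_of_nonneg_left (hlower q hq v hqv) (by positivity)
    calc |φ u| ≤ (M / c * |u - v| + 1) * |φ v| := by linarith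
      _ ≤ _ := mul_le_mul_of_nonneg_right (Real.add_one_le_exp _) (abs_nonneg _)

/-- Mañé's theorem (Proposition 2.3): uniform expansion outside a neighborhood
of the critical set, for a C² interval map with non-flat critical points whose
periodic points are all hyperbolic repelling. -/
theorem stmt_15 (f : ℝ → ℝ)
    (hC2 : ContDiffOn ℝ 2 f (Icc (0:ℝ) 1))
    (hmaps : MapsTo f (Icc (0:ℝ) 1) (Icc (0:ℝ) 1))
    (hfin : {x ∈ Icc (0:ℝ) 1 | deriv f x = 0}.Finite)
    (hnonflat : ∀ c ∈ {x ∈ Icc (0:ℝ) 1 | deriv f x = 0},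
      ∃ ℓ : ℝ, 1 < ℓ ∧ ∃ C₁ C₂ : ℝ, 0 < C₁ ∧ 0 < C₂ ∧ ∃ r > 0,
        ∀ x ∈ Icc (0:ℝ) 1, |x - c| < r →
          C₁ * |x - c| ^ (ℓ - 1) ≤ |deriv f x| ∧
          |deriv f x| ≤ C₂ * |x - c| ^ (ℓ - 1))
    (hrep : ∀ x ∈ Icc (0:ℝ) 1, ∀ n : ℕ, 1 ≤ n → f^[n] x = x →
      1 < |deriv (f^[n]) x|)
    (U : Set ℝ) (hU : IsOpen U)
    (hcrit : {x ∈ Icc (0:ℝ) 1 | deriv f x = 0} ⊆ U) :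
    ∃ C : ℝ, 0 < C ∧ ∃ lam : ℝ, 1 < lam ∧
      ∀ x ∈ Icc (0:ℝ) 1, ∀ n : ℕ, 1 ≤ n →
        (∀ i < n, f^[i] x ∉ U) → C * lam ^ n ≤ |deriv (f^[n]) x| := by
  have hne : ∀ x ∈ Icc (0 : ℝ) 1 \ U, deriv f x ≠ 0 := fun x hx h0 => hx.2 (hcrit ⟨hx.1, h0⟩)
  obtain ⟨F, φ, c, C, ρ, h, hEq, hderiv⟩ := exists_repellingSystem hC2 hmaps hrep
    (isCompact_Icc.diff hU) sdiff_subset hne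
  obtain ⟨C', hC', lam, hlam, hexp⟩ := h.exists_uniform_expansion
  refine ⟨C', hC', lam, hlam, fun x hx n hn1 hn => ?_⟩
  have hI : ∀ i, f^[i] x ∈ Icc (0 : ℝ) 1 := fun i => hmaps.iterate i hx
  have hit : ∀ i, F^[i] x = f^[i] x := by
    intro i
    induction i with
    | zero => rfl
    | succ i ih => rw [Function.iterate_succ_apply', Function.iterate_succ_apply', ih, hEq (hI i)]
  have hd : DifferentiableAt ℝ f^[n] x := by
    clear hn1
    induction n with
    | zero => exact differentiableAt_id
    | succ n ih =>
      rw [Function.iterate_succ']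
      exact (differentiableAt_of_deriv_ne_zero (hne _ ⟨hI n, hn n (by omega)⟩)).comp x
        (ih (fun i hi => hn i (by omega)))
  rw [hderiv x hx n hd]
  exact hexp n x fun i hi => by
    rw [hit]
    exact ⟨hI i, hn i hi⟩
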